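/- arXiv:2408.09684 — 2 statements merged into one kernel-verified Lean document; each statement's English description precedes it below -/
import Mathlib

section
/- Let G = (V,E) be a finite oriented graph that is dipath oriented, and let (h_v)_{v∈V} be a Hamiltonian compatible with G. Then for all x, y ∈ ℂ, H · T_G(x) = T_G(x) · H and T_G(x) · T_G(y) = T_G(y) · T_G(x). -/
noncomputable section
open scoped Classical

/-- `ω = exp(2πi/d)`, the primitive `d`-th root of unity. -/
def omegaD (d : ℕ) : ℂ := Complex.exp (2 * Real.pi * Complex.I / d)

/-- A finite set of vertices is independent if its elements are pairwise non-adjacent. -/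
def IsIndep {V : Type*} (G : SimpleGraph V) (S : Finset V) : Prop :=
  ∀ u ∈ S, ∀ w ∈ S, u ≠ w → ¬ G.Adj u w

/-- The independence number `α` of the induced subgraph of `G` on the vertex set `A`. -/
def indepNum {V : Type*} (G : SimpleGraph V) (A : Finset V) : ℕ :=
  (A.powerset.filter (fun S => IsIndep G S)).sup Finset.card

/-- The ordered product `∏_{v ∈ S} h v` (in increasing order of vertices). -/
def hProd {V : Type*} [LinearOrder V] {N : ℕ} (h : V → Matrix (Fin N) (Fin N) ℂ)
    (S : Finset V) : Matrix (Fin N) (Fin N) ℂ :=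
  ((S.sort (· ≤ ·)).map h).prod

/-- The independent set charge `Q^{(i)}` of the induced subgraph on `A`. -/
def chargeQ {V : Type*} [LinearOrder V] {N : ℕ} (G : SimpleGraph V)
    (h : V → Matrix (Fin N) (Fin N) ℂ) (A : Finset V) (i : ℕ) :
    Matrix (Fin N) (Fin N) ℂ :=
  ∑ S ∈ A.powerset.filter (fun S => IsIndep G S ∧ S.card = i), hProd h S

/-- The transfer operator `T(x) = ∑_{k=0}^{α} (−x)^k Q^{(k)}` of the induced subgraph on `A`. -/
def transferT {V : Type*} [LinearOrder V] {N : ℕ} (G : SimpleGraph V)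
    (h : V → Matrix (Fin N) (Fin N) ℂ) (A : Finset V) (x : ℂ) :
    Matrix (Fin N) (Fin N) ℂ :=
  ∑ k ∈ Finset.range (indepNum G A + 1), (-x) ^ k • chargeQ G h A k
/-- An induced path `p 0, p 1, …, p n` in `G`: the vertices are distinct and two of them
are adjacent if and only if they are consecutive. -/
def IsInducedPath {V : Type*} (G : SimpleGraph V) {n : ℕ} (p : Fin (n + 1) → V) : Prop :=
  Function.Injective p ∧
    ∀ i j : Fin (n + 1), G.Adj (p i) (p j) ↔ ((i : ℕ) + 1 = (j : ℕ) ∨ (j : ℕ) + 1 = (i : ℕ))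

/-- A path is a dipath if all of its edges are oriented consistently from one end to the other. -/
def IsDipath {V : Type*} (dir : V → V → Prop) {n : ℕ} (p : Fin (n + 1) → V) : Prop :=
  (∀ i : Fin n, dir (p i.castSucc) (p i.succ)) ∨ (∀ i : Fin n, dir (p i.succ) (p i.castSucc))

/-- An oriented graph is dipath oriented if every induced path is a dipath. -/
def DipathOriented {V : Type*} (G : SimpleGraph V) (dir : V → V → Prop) : Prop :=
  ∀ (n : ℕ) (p : Fin (n + 1) → V), IsInducedPath G p → IsDipath dir p
open Relation in
lemma sink_unique {V : Type*} (D : V → V → Prop)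
    (hout : ∀ v x y, D v x → D v y → x = y) (s t : V)
    (hs : ∀ x, ¬ D s x) (ht : ∀ x, ¬ D t x) (hst : EqvGen D s t) : s = t := by
  have key : ∀ u v, EqvGen D u v → (ReflTransGen D u s ↔ ReflTransGen D v s) := by
    intro u v huv
    induction huv with
    | rel u v huv =>
      constructor
      · intro hu
        rcases ReflTransGen.cases_head hu with rfl | ⟨w, hw, hws⟩
        · exact absurd huv (hs _)
        · rw [hout u v w huv hw]; exact hws
      · intro hv
        exact ReflTransGen.head huv hv
    | refl => rfl
    | symm _ _ _ ih => exact ih.symm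
    | trans _ _ _ _ _ ih1 ih2 => exact ih1.trans ih2
  have h1 := (key s t hst).1 ReflTransGen.refl
  rcases ReflTransGen.cases_head h1 with h | ⟨w, hw, _⟩
  · exact h.symm
  · exact absurd hw (ht _)

open Relation in
lemma eqvGen_flip {V : Type*} (D : V → V → Prop) (u v : V) (h : EqvGen D u v) :
    EqvGen (fun a b => D b a) u v := by
  induction h with
  | rel u v huv => exact EqvGen.symm _ _ (EqvGen.rel _ _ huv)
  | refl => exact EqvGen.refl _
  | symm _ _ _ ih => exact EqvGen.symm _ _ ih
  | trans _ _ _ _ _ ih1 ih2 => exact EqvGen.trans _ _ _ ih1 ih2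

open Relation in
lemma exists_out {V : Type*} (D : V → V → Prop) (S T : Finset V)
    (hD : ∀ u v, D u v → (u ∈ S ∧ u ∉ T ∧ v ∈ T ∧ v ∉ S) ∨ (u ∈ T ∧ u ∉ S ∧ v ∈ S ∧ v ∉ T))
    (hout : ∀ v x y, D v x → D v y → x = y)
    (hin : ∀ v x y, D x v → D y v → x = y) (v : V) (hv : v ∈ S)
    (hlt : (S.filter (EqvGen D v)).card < (T.filter (EqvGen D v)).card) : ∃ b, D v b := by
  by_contra hno
  push Not at hno
  have hlt2 := Finset.card_sdiff_lt_card_sdiff_iff.2 hlt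
  have hall : ∀ b ∈ T.filter (EqvGen D v) \ S.filter (EqvGen D v), ∃ x, D b x := by
    intro b hb
    by_contra hb2
    push Not at hb2
    simp only [Finset.mem_sdiff, Finset.mem_filter] at hb
    have := sink_unique D hout v b hno hb2 hb.1.2
    subst this
    exact hb.2 ⟨hv, hb.1.2⟩
  choose! f hf using hall
  have : (T.filter (EqvGen D v) \ S.filter (EqvGen D v)).card ≤
      (S.filter (EqvGen D v) \ T.filter (EqvGen D v)).card := by
    apply Finset.card_le_card_of_injOn f
    · intro b hb
      have hfb := hf b hb
      have hb' : b ∈ T.filter (EqvGen D v) \ S.filter (EqvGen D v) := hb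
      simp only [Finset.mem_sdiff, Finset.mem_filter] at hb'
      have hr : EqvGen D v (f b) := EqvGen.trans _ _ _ hb'.1.2 (EqvGen.rel _ _ hfb)
      rcases hD _ _ hfb with h1 | h1
      · exact absurd hb'.1.1 h1.2.1
      · simp only [Finset.coe_sdiff, Set.mem_sdiff, Finset.mem_coe, Finset.mem_filter]
        exact ⟨⟨h1.2.2.1, hr⟩, fun h2 => h1.2.2.2 h2.1⟩
    · intro b hb c hc hbc
      have h1 := hf b hb
      have h2 := hf c hc
      rw [hbc] at h1
      exact hin _ _ _ h1 h2
  omega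

/-- the commutation scalar -/
def csc {V : Type*} (dir : V → V → Prop) (w : ℂ) (u v : V) : ℂ :=
  (if dir u v then w else 1) * (if dir v u then w⁻¹ else 1)

lemma csc_swap {V : Type*} (dir : V → V → Prop) (w : ℂ) (u v : V) :
    csc dir w u v = (csc dir w v u)⁻¹ := by
  unfold csc
  split_ifs <;> simp

lemma hProd_comm_scalar {V : Type*} [LinearOrder V] {N : ℕ} (h : V → Matrix (Fin N) (Fin N) ℂ)
    (c : V → V → ℂ) (hc : ∀ u v, h u * h v = c u v • (h v * h u)) (A B : Finset V) :
    hProd h A * hProd h B = (∏ a ∈ A, ∏ b ∈ B, c a b) • (hProd h B * hProd h A) := by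
  have h1 : ∀ (a : V) (L : List V),
      h a * (L.map h).prod = (L.map (c a)).prod • ((L.map h).prod * h a) := by
    intro a L
    induction L with
    | nil => simp
    | cons b L ih =>
      simp only [List.map_cons, List.prod_cons]
      rw [← mul_assoc, hc, smul_mul_assoc, mul_assoc, ih, mul_smul_comm, smul_smul, mul_assoc]
  have h2 : ∀ (K L : List V),
      (K.map h).prod * (L.map h).prod =
        (K.map (fun a => (L.map (c a)).prod)).prod • ((L.map h).prod * (K.map h).prod) := by
    intro K L
    induction K with
    | nil => simp
    | cons a K ih =>
      simp only [List.map_cons, List.prod_cons]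
      rw [mul_assoc, ih, mul_smul_comm, ← mul_assoc, h1, smul_mul_assoc, smul_smul, mul_assoc,
        mul_comm (List.prod _) (List.prod _)]
  have h3 : ∀ (A : Finset V) (f : V → ℂ), ((A.sort (· ≤ ·)).map f).prod = ∏ a ∈ A, f a := by
    intro A f
    rw [Finset.prod, ← Multiset.prod_coe, ← Multiset.map_coe, Finset.sort_eq]
  unfold hProd
  rw [h2, h3]
  simp only [h3]

lemma hProd_union {V : Type*} [LinearOrder V] {N : ℕ} (h : V → Matrix (Fin N) (Fin N) ℂ)
    (A B : Finset V) (hAB : Disjoint A B)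
    (hc : ∀ u ∈ A ∪ B, ∀ v ∈ A ∪ B, Commute (h u) (h v)) :
    hProd h (A ∪ B) = hProd h A * hProd h B := by
  have key : ∀ (S : Finset V) (hS : ∀ u ∈ S, ∀ v ∈ S, Commute (h u) (h v)),
      hProd h S = S.noncommProd h (fun u hu v hv _ => hS u hu v hv) := by
    intro S hS
    unfold hProd Finset.noncommProd
    rw [← Multiset.noncommProd_coe]
    · congr 1
      rw [← Multiset.map_coe, Finset.sort_eq]
    · intro x hx y hy _
      simp only [Multiset.mem_coe, List.mem_map, Finset.mem_sort, Set.mem_ofPred_eq] at hx hy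
      obtain ⟨u, hu, rfl⟩ := hx
      obtain ⟨v, hv, rfl⟩ := hy
      exact hS u hu v hv
  rw [key _ hc, key A (fun u hu v hv => hc u (Finset.mem_union_left _ hu) v
      (Finset.mem_union_left _ hv)), key B (fun u hu v hv => hc u (Finset.mem_union_right _ hu) v
      (Finset.mem_union_right _ hv))]
  exact Finset.noncommProd_union_of_disjoint hAB _ _

/-- directed edges inside `M` -/
def DD {V : Type*} (dir : V → V → Prop) (M : Finset V) (u v : V) : Prop :=
  dir u v ∧ u ∈ M ∧ v ∈ M

/-- size of the part of `S` in the component of `v` -/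
def fsz {V : Type*} (dir : V → V → Prop) (M S : Finset V) (v : V) : ℕ :=
  (S.filter (Relation.EqvGen (DD dir M) v)).card

/-- union of balanced components -/
def WW {V : Type*} [Fintype V] [LinearOrder V] (dir : V → V → Prop) (S T : Finset V) : Finset V :=
  Finset.univ.filter (fun v => fsz dir (S ∪ T) S v = fsz dir (S ∪ T) T v)

/-- swap on balanced components -/
def swp {V : Type*} [Fintype V] [LinearOrder V] (dir : V → V → Prop) (S T : Finset V) : Finset V :=
  (T ∩ WW dir S T) ∪ (S \ WW dir S T)

lemma WW_comm {V : Type*} [Fintype V] [LinearOrder V] (dir : V → V → Prop) (S T : Finset V) :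
    WW dir S T = WW dir T S := by
  unfold WW
  rw [Finset.union_comm]
  ext v
  simp [eq_comm]

lemma eqv_left {V : Type*} (D : V → V → Prop) {u v : V} (h : Relation.EqvGen D u v) (x : V) :
    Relation.EqvGen D u x ↔ Relation.EqvGen D v x :=
  ⟨fun k => Relation.EqvGen.trans _ _ _ (Relation.EqvGen.symm _ _ h) k,
    fun k => Relation.EqvGen.trans _ _ _ h k⟩

lemma fsz_congr {V : Type*} (dir : V → V → Prop) (M S : Finset V) {u v : V}
    (h : Relation.EqvGen (DD dir M) u v) : fsz dir M S u = fsz dir M S v := by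
  unfold fsz
  congr 1
  ext x
  simp only [Finset.mem_filter, eqv_left _ h]

lemma WW_congr {V : Type*} [Fintype V] [LinearOrder V] (dir : V → V → Prop) (S T : Finset V)
    {u v : V} (h : Relation.EqvGen (DD dir (S ∪ T)) u v) : u ∈ WW dir S T ↔ v ∈ WW dir S T := by
  simp only [WW, Finset.mem_filter, Finset.mem_univ, true_and, fsz_congr dir _ _ h]

lemma swp_union {V : Type*} [Fintype V] [LinearOrder V] (dir : V → V → Prop) (S T : Finset V) :
    swp dir S T ∪ swp dir T S = S ∪ T := by
  unfold swp
  rw [WW_comm dir T S]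
  ext v
  simp only [Finset.mem_union, Finset.mem_inter, Finset.mem_sdiff]
  tauto

lemma fsz_swp {V : Type*} [Fintype V] [LinearOrder V] (dir : V → V → Prop) (S T : Finset V)
    (v : V) : fsz dir (S ∪ T) (swp dir S T) v =
      if v ∈ WW dir S T then fsz dir (S ∪ T) T v else fsz dir (S ∪ T) S v := by
  have : ∀ x, Relation.EqvGen (DD dir (S ∪ T)) v x → (v ∈ WW dir S T ↔ x ∈ WW dir S T) :=
    fun x hx => WW_congr dir S T hx
  unfold fsz
  split_ifs with hv
  · congr 1
    ext x
    simp only [swp, Finset.mem_filter, Finset.mem_union, Finset.mem_inter, Finset.mem_sdiff]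
    have := this x
    tauto
  · congr 1
    ext x
    simp only [swp, Finset.mem_filter, Finset.mem_union, Finset.mem_inter, Finset.mem_sdiff]
    have := this x
    tauto

lemma WW_swp {V : Type*} [Fintype V] [LinearOrder V] (dir : V → V → Prop) (S T : Finset V) :
    WW dir (swp dir S T) (swp dir T S) = WW dir S T := by
  ext v
  have h1 := fsz_swp dir S T v
  have h2 := fsz_swp dir T S v
  rw [Finset.union_comm T S, WW_comm dir T S] at h2
  have h3 : v ∈ WW dir S T ↔ fsz dir (S ∪ T) S v = fsz dir (S ∪ T) T v := by simp [WW]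
  have h4 : v ∈ WW dir (swp dir S T) (swp dir T S) ↔
      fsz dir (S ∪ T) (swp dir S T) v = fsz dir (S ∪ T) (swp dir T S) v := by
    simp [WW, swp_union]
  rw [h4, h1, h2]
  split_ifs with hv
  · simp [hv, h3.1 hv]
  · rw [h3]

lemma swp_swp {V : Type*} [Fintype V] [LinearOrder V] (dir : V → V → Prop) (S T : Finset V) :
    swp dir (swp dir S T) (swp dir T S) = S := by
  have h0 : swp dir (swp dir S T) (swp dir T S) =
      (swp dir T S ∩ WW dir S T) ∪ (swp dir S T \ WW dir S T) := by
    rw [← WW_swp dir S T]; rfl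
  rw [h0]
  unfold swp
  rw [WW_comm dir T S]
  ext v
  simp only [Finset.mem_union, Finset.mem_inter, Finset.mem_sdiff]
  tauto

lemma swp_card {V : Type*} [Fintype V] [LinearOrder V] (dir : V → V → Prop) (S T : Finset V) :
    (swp dir S T).card = S.card := by
  have hcard : (T ∩ WW dir S T).card = (S ∩ WW dir S T).card := by
    let st : Setoid V := Relation.EqvGen.setoid (DD dir (S ∪ T))
    have hq : ∀ u v : V, (Quotient.mk st v = Quotient.mk st u) ↔
        Relation.EqvGen (DD dir (S ∪ T)) u v := by
      intro u v
      rw [Quotient.eq]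
      exact ⟨fun h => Relation.EqvGen.symm _ _ h, fun h => Relation.EqvGen.symm _ _ h⟩
    rw [Finset.card_eq_sum_card_fiberwise (f := Quotient.mk st) (t := Finset.univ)
        (fun x _ => Finset.mem_coe.2 (Finset.mem_univ _)),
      Finset.card_eq_sum_card_fiberwise (f := Quotient.mk st) (t := Finset.univ)
        (s := S ∩ WW dir S T) (fun x _ => Finset.mem_coe.2 (Finset.mem_univ _))]
    apply Finset.sum_congr rfl
    intro q _
    obtain ⟨v, rfl⟩ := Quotient.exists_rep q
    have hf : ∀ X : Finset V, (X ∩ WW dir S T).filter (fun a => Quotient.mk st a = Quotient.mk st v)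
        = if v ∈ WW dir S T then X.filter (Relation.EqvGen (DD dir (S ∪ T)) v) else ∅ := by
      intro X
      ext x
      have := fun hx => WW_congr dir S T (u := v) (v := x) hx
      split_ifs with hv <;>
      · simp only [Finset.mem_filter, Finset.mem_inter, hq, Finset.notMem_empty]
        tauto
    rw [hf, hf]
    split_ifs with hv
    · simp only [WW, Finset.mem_filter, Finset.mem_univ, true_and] at hv
      exact hv.symm
    · rfl
  unfold swp
  rw [Finset.card_union_of_disjoint]
  · rw [hcard, Finset.card_inter_add_card_sdiff]
  · rw [Finset.disjoint_left]
    intro x hx hx2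
    simp only [Finset.mem_inter, Finset.mem_sdiff] at hx hx2
    exact hx2.2 hx.2

lemma no_cross {V : Type*} [Fintype V] [LinearOrder V] (G : SimpleGraph V) (dir : V → V → Prop)
    (hdir' : ∀ u v, G.Adj u v → (dir u v ↔ ¬ dir v u)) (S T : Finset V) (u v : V)
    (hu : u ∈ S ∪ T) (hv : v ∈ S ∪ T) (huv : G.Adj u v) :
    Relation.EqvGen (DD dir (S ∪ T)) u v := by
  by_cases h1 : dir u v
  · exact Relation.EqvGen.rel _ _ ⟨h1, hu, hv⟩
  · have : dir v u := by
      by_contra h2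
      exact h1 ((hdir' u v huv).2 h2)
    exact Relation.EqvGen.symm _ _ (Relation.EqvGen.rel _ _ ⟨this, hv, hu⟩)

lemma swp_indep {V : Type*} [Fintype V] [LinearOrder V] (G : SimpleGraph V) (dir : V → V → Prop)
    (hdir' : ∀ u v, G.Adj u v → (dir u v ↔ ¬ dir v u)) (S T : Finset V)
    (hS : IsIndep G S) (hT : IsIndep G T) : IsIndep G (swp dir S T) := by
  intro u hu v hv hne hadj
  have hu' : u ∈ S ∪ T := by
    rw [← swp_union dir S T]; exact Finset.mem_union_left _ hu
  have hv' : v ∈ S ∪ T := by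
    rw [← swp_union dir S T]; exact Finset.mem_union_left _ hv
  have h1 := WW_congr dir S T (no_cross G dir hdir' S T u v hu' hv' hadj)
  simp only [swp, Finset.mem_union, Finset.mem_inter, Finset.mem_sdiff] at hu hv
  rcases hu with hu | hu <;> rcases hv with hv | hv
  · exact hT u hu.1 v hv.1 hne hadj
  · exact hv.2 (h1.1 hu.2)
  · exact hu.2 (h1.2 hv.2)
  · exact hS u hu.1 v hv.1 hne hadj

lemma dip3 {V : Type*} (G : SimpleGraph V) (dir : V → V → Prop)
    (hdip : DipathOriented G dir) (u v w : V) (huw : u ≠ w) (h1 : G.Adj u v) (h2 : G.Adj v w)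
    (h3 : ¬ G.Adj u w) : (dir u v ∧ dir v w) ∨ (dir v u ∧ dir w v) := by
  have hp : IsInducedPath G (n := 2) ![u, v, w] := by
    have a1 := h1.ne
    have a2 := h2.ne
    have a3 := h1.symm
    have a4 := h2.symm
    have a5 : ¬ G.Adj w u := fun h => h3 h.symm
    constructor
    · intro i j hij
      fin_cases i <;> fin_cases j <;> simp_all
    · intro i j
      fin_cases i <;> fin_cases j <;> simp_all
  rcases hdip 2 _ hp with h | h
  · left; exact ⟨h 0, h 1⟩
  · right; exact ⟨h 0, h 1⟩

/-- in a smaller side, the scalars multiply to one -/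
lemma local_prod {V : Type*} [Fintype V] [LinearOrder V] (G : SimpleGraph V) (dir : V → V → Prop)
    (hdir : ∀ u v, dir u v → G.Adj u v)
    (hdir' : ∀ u v, G.Adj u v → (dir u v ↔ ¬ dir v u))
    (hdip : DipathOriented G dir) (w : ℂ) (hw : w ≠ 0) (S T : Finset V)
    (hS : IsIndep G S) (hT : IsIndep G T) (v : V) (hv : v ∈ S)
    (hlt : fsz dir (S ∪ T) S v < fsz dir (S ∪ T) T v) (Y : Finset V) (hYT : Y ⊆ T)
    (hY : ∀ b ∈ T, Relation.EqvGen (DD dir (S ∪ T)) v b → b ∈ Y) :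
    ∏ b ∈ Y, csc dir w v b = 1 := by
  have hD : ∀ a b, DD dir (S ∪ T) a b →
      (a ∈ S ∧ a ∉ T ∧ b ∈ T ∧ b ∉ S) ∨ (a ∈ T ∧ a ∉ S ∧ b ∈ S ∧ b ∉ T) := by
    rintro a b ⟨hab, ha, hb⟩
    have hadj := hdir _ _ hab
    have k1 : a ∈ S → b ∉ S := fun h1 h2 => hS a h1 b h2 hadj.ne hadj
    have k2 : a ∈ T → b ∉ T := fun h1 h2 => hT a h1 b h2 hadj.ne hadj
    simp only [Finset.mem_union] at ha hb
    tauto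
  have hnadj : ∀ a b c, (DD dir (S ∪ T) a b ∨ DD dir (S ∪ T) b a) →
      (DD dir (S ∪ T) a c ∨ DD dir (S ∪ T) c a) → b ≠ c → ¬ G.Adj b c := by
    intro a b c hb hc hne
    have hnb : ∀ x, (DD dir (S ∪ T) a x ∨ DD dir (S ∪ T) x a) →
        (a ∈ S ∧ a ∉ T ∧ x ∈ T) ∨ (a ∉ S ∧ a ∈ T ∧ x ∈ S) := by
      rintro x (hx | hx)
      · rcases hD _ _ hx with e | e
        · exact Or.inl ⟨e.1, e.2.1, e.2.2.1⟩
        · exact Or.inr ⟨e.2.1, e.1, e.2.2.1⟩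
      · rcases hD _ _ hx with e | e
        · exact Or.inr ⟨e.2.2.2, e.2.2.1, e.1⟩
        · exact Or.inl ⟨e.2.2.1, e.2.2.2, e.1⟩
    rcases hnb b hb with e1 | e1 <;> rcases hnb c hc with e2 | e2
    · exact hT b e1.2.2 c e2.2.2 hne
    · exact absurd e1.1 e2.1
    · exact absurd e2.1 e1.1
    · exact hS b e1.2.2 c e2.2.2 hne
  have asym : ∀ a b, dir a b → ¬ dir b a := fun a b hab => (hdir' a b (hdir a b hab)).1 hab
  have hout : ∀ a x y, DD dir (S ∪ T) a x → DD dir (S ∪ T) a y → x = y := by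
    intro a x y hx hy
    by_contra hne
    rcases dip3 G dir hdip x a y hne (hdir _ _ hx.1).symm (hdir _ _ hy.1)
      (hnadj a x y (Or.inl hx) (Or.inl hy) hne) with k | k
    · exact asym _ _ hx.1 k.1
    · exact asym _ _ hy.1 k.2
  have hin : ∀ a x y, DD dir (S ∪ T) x a → DD dir (S ∪ T) y a → x = y := by
    intro a x y hx hy
    by_contra hne
    rcases dip3 G dir hdip x a y hne (hdir _ _ hx.1) (hdir _ _ hy.1).symm
      (hnadj a x y (Or.inr hx) (Or.inr hy) hne) with k | k
    · exact asym _ _ hy.1 k.2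
    · exact asym _ _ hx.1 k.1
  obtain ⟨p, hp⟩ := exists_out (DD dir (S ∪ T)) S T hD hout hin v hv hlt
  have hflip : ∀ X : Finset V, X.filter (Relation.EqvGen (DD dir (S ∪ T)) v) =
      X.filter (Relation.EqvGen (fun a b => DD dir (S ∪ T) b a) v) := by
    intro X
    apply Finset.filter_congr
    intro x _
    exact ⟨eqvGen_flip _ _ _, eqvGen_flip _ _ _⟩
  obtain ⟨q, hq⟩ := exists_out (fun a b => DD dir (S ∪ T) b a) S T
    (fun a b hab => by have := hD _ _ hab; tauto) hin hout v hv
    (by rw [← hflip, ← hflip]; exact hlt)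
  have hvT : v ∉ T := by
    have := hD _ _ hp
    tauto
  have hpY : p ∈ Y := hY p (by have := hD _ _ hp; tauto) (Relation.EqvGen.rel _ _ hp)
  have hqY : q ∈ Y := hY q (by have := hD _ _ hq; tauto)
    (Relation.EqvGen.symm _ _ (Relation.EqvGen.rel _ _ hq))
  have hvM : v ∈ S ∪ T := Finset.mem_union_left _ hv
  unfold csc
  rw [Finset.prod_mul_distrib, Finset.prod_eq_single p, Finset.prod_eq_single q]
  · simp [hp.1, hq.1, hw]
  · intro b hb hbq
    rw [if_neg]
    intro hd
    exact hbq (hin v b q ⟨hd, Finset.mem_union_right _ (hYT hb), hvM⟩ hq)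
  · intro hn; exact absurd hqY hn
  · intro b hb hbp
    rw [if_neg]
    intro hd
    exact hbp (hout v b p ⟨hd, hvM, Finset.mem_union_right _ (hYT hb)⟩ hp)
  · intro hn; exact absurd hpY hn

lemma unbal_prod {V : Type*} [Fintype V] [LinearOrder V] (G : SimpleGraph V) (dir : V → V → Prop)
    (hdir : ∀ u v, dir u v → G.Adj u v)
    (hdir' : ∀ u v, G.Adj u v → (dir u v ↔ ¬ dir v u))
    (hdip : DipathOriented G dir) (w : ℂ) (hw : w ≠ 0) (S T : Finset V)
    (hS : IsIndep G S) (hT : IsIndep G T) :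
    ∏ a ∈ S \ WW dir S T, ∏ b ∈ T \ WW dir S T, csc dir w a b = 1 := by
  set M := S ∪ T with hM
  have hsub : (S \ WW dir S T).filter (fun a => fsz dir M T a < fsz dir M S a) ⊆ S \ WW dir S T :=
    Finset.filter_subset _ _
  rw [← Finset.prod_subset hsub]
  · rw [Finset.prod_comm]
    apply Finset.prod_eq_one
    intro b hb
    rw [Finset.mem_sdiff] at hb
    by_cases hlt : fsz dir M T b < fsz dir M S b
    · have := local_prod G dir hdir hdir' hdip w hw T S hT hS b hb.1
        (by rw [Finset.union_comm]; exact hlt)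
        ((S \ WW dir S T).filter (fun a => fsz dir M T a < fsz dir M S a))
        (hsub.trans Finset.sdiff_subset) (by
          intro a ha hba
          rw [Finset.union_comm] at hba
          rw [Finset.mem_filter, Finset.mem_sdiff, ← WW_congr dir S T hba,
            ← fsz_congr dir M S hba, ← fsz_congr dir M T hba]
          exact ⟨⟨ha, hb.2⟩, hlt⟩)
      rw [← inv_inj, ← Finset.prod_inv_distrib, inv_one, ← this]
      apply Finset.prod_congr rfl
      intro a _
      rw [csc_swap dir w b a]
    · apply Finset.prod_eq_one
      intro a ha
      rw [Finset.mem_filter, Finset.mem_sdiff] at ha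
      have hn : ¬ G.Adj a b := by
        intro hadj
        have := no_cross G dir hdir' S T a b (Finset.mem_union_left _ ha.1.1)
          (Finset.mem_union_right _ hb.1) hadj
        rw [← fsz_congr dir M S this, ← fsz_congr dir M T this] at hlt
        exact hlt ha.2
      unfold csc
      rw [if_neg (fun k => hn (hdir _ _ k)), if_neg (fun k => hn (hdir _ _ k).symm), mul_one]
  · intro a ha hna
    rw [Finset.mem_filter, not_and] at hna
    have h1 := hna ha
    rw [Finset.mem_sdiff] at ha
    have hne : fsz dir M S a ≠ fsz dir M T a := by
      intro he
      exact ha.2 (by simp only [WW, Finset.mem_filter, Finset.mem_univ, true_and]; exact he)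
    apply local_prod G dir hdir hdir' hdip w hw S T hS hT a ha.1 (by rw [← hM]; omega) _ Finset.sdiff_subset
    intro b hb hab
    rw [Finset.mem_sdiff, ← WW_congr dir S T hab]
    exact ⟨hb, ha.2⟩

lemma chargeQ_comm {V : Type*} [Fintype V] [LinearOrder V] {N : ℕ}
    (G : SimpleGraph V) (dir : V → V → Prop)
    (hdir : ∀ u v, dir u v → G.Adj u v)
    (hdir' : ∀ u v, G.Adj u v → (dir u v ↔ ¬ dir v u))
    (hdip : DipathOriented G dir)
    (h : V → Matrix (Fin N) (Fin N) ℂ) (w : ℂ) (hw : w ≠ 0)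
    (hcd : ∀ u v, dir u v → h u * h v = w • (h v * h u))
    (hcn : ∀ u v, u ≠ v → ¬ G.Adj u v → h u * h v = h v * h u) (i j : ℕ) :
    chargeQ G h Finset.univ i * chargeQ G h Finset.univ j =
      chargeQ G h Finset.univ j * chargeQ G h Finset.univ i := by
  have asym : ∀ a b, dir a b → ¬ dir b a := fun a b hab => (hdir' a b (hdir a b hab)).1 hab
  have hc : ∀ u v, h u * h v = csc dir w u v • (h v * h u) := by
    intro u v
    unfold csc
    by_cases h1 : dir u v
    · rw [if_pos h1, if_neg (asym _ _ h1), mul_one, hcd u v h1]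
    · by_cases h2 : dir v u
      · rw [if_neg h1, if_pos h2, one_mul, hcd v u h2, smul_smul, inv_mul_cancel₀ hw, one_smul]
      · rw [if_neg h1, if_neg h2, one_mul, one_smul]
        by_cases huv : u = v
        · rw [huv]
        · exact hcn u v huv (fun hadj => h1 ((hdir' u v hadj).2 h2))
  have hcomm : ∀ u v, ¬ G.Adj u v → Commute (h u) (h v) := by
    intro u v hn
    by_cases huv : u = v
    · rw [huv]
    · exact hcn u v huv hn
  have hind : ∀ S, IsIndep G S → ∀ u ∈ S, ∀ v ∈ S, Commute (h u) (h v) := by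
    intro S hS u hu v hv
    by_cases huv : u = v
    · rw [huv]
    · exact hcomm u v (hS u hu v hv huv)
  have key : ∀ S T, IsIndep G S → IsIndep G T →
      hProd h S * hProd h T = hProd h (swp dir T S) * hProd h (swp dir S T) := by
    intro S T hS hT
    have hd : ∀ X Y W : Finset V, Disjoint (X ∩ W) (Y \ W) := by
      intro X Y W
      rw [Finset.disjoint_left]
      intro x hx hx2
      exact (Finset.mem_sdiff.1 hx2).2 (Finset.mem_inter.1 hx).2
    have iS := hind S hS
    have iT := hind T hT
    have iS' := hind _ (swp_indep G dir hdir' S T hS hT)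
    have iT' := hind _ (swp_indep G dir hdir' T S hT hS)
    have hU := unbal_prod G dir hdir hdir' hdip w hw S T hS hT
    have hcr : ∀ a ∈ S ∪ T, ∀ b ∈ S ∪ T, a ∉ WW dir S T → b ∈ WW dir S T → csc dir w a b = 1 := by
      intro a ha b hb haW hbW
      have hn : ¬ G.Adj a b := by
        intro hadj
        exact haW ((WW_congr dir S T (no_cross G dir hdir' S T a b ha hb hadj)).2 hbW)
      unfold csc
      rw [if_neg (fun k => hn (hdir _ _ k)), if_neg (fun k => hn (hdir _ _ k).symm), mul_one]
    unfold swp at *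
    rw [WW_comm dir T S] at *
    generalize WW dir S T = W at *
    have eS : hProd h S = hProd h (S ∩ W) * hProd h (S \ W) := by
      have e : S = (S ∩ W) ∪ (S \ W) := by
        ext x; simp only [Finset.mem_union, Finset.mem_inter, Finset.mem_sdiff]; tauto
      rw [← hProd_union h _ _ (hd _ _ _) (by rw [← e]; exact iS), ← e]
    have eT : hProd h T = hProd h (T ∩ W) * hProd h (T \ W) := by
      have e : T = (T ∩ W) ∪ (T \ W) := by
        ext x; simp only [Finset.mem_union, Finset.mem_inter, Finset.mem_sdiff]; tauto
      rw [← hProd_union h _ _ (hd _ _ _) (by rw [← e]; exact iT), ← e]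
    rw [eS, eT, hProd_union h _ _ (hd _ _ _) iT', hProd_union h _ _ (hd _ _ _) iS']
    have c1 : hProd h (S \ W) * hProd h (T ∩ W) = hProd h (T ∩ W) * hProd h (S \ W) := by
      rw [hProd_comm_scalar h _ hc, Finset.prod_eq_one, one_smul]
      intro a ha
      apply Finset.prod_eq_one
      intro b hb
      rw [Finset.mem_sdiff] at ha
      rw [Finset.mem_inter] at hb
      exact hcr a (Finset.mem_union_left _ ha.1) b (Finset.mem_union_right _ hb.1) ha.2 hb.2
    have c2 : hProd h (T \ W) * hProd h (T ∩ W) = hProd h (T ∩ W) * hProd h (T \ W) := by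
      rw [hProd_comm_scalar h _ hc, Finset.prod_eq_one, one_smul]
      intro a ha
      apply Finset.prod_eq_one
      intro b hb
      rw [Finset.mem_sdiff] at ha
      rw [Finset.mem_inter] at hb
      exact hcr a (Finset.mem_union_right _ ha.1) b (Finset.mem_union_right _ hb.1) ha.2 hb.2
    have c3 : hProd h (S \ W) * hProd h (T \ W) = hProd h (T \ W) * hProd h (S \ W) := by
      rw [hProd_comm_scalar h _ hc, hU, one_smul]
    calc hProd h (S ∩ W) * hProd h (S \ W) * (hProd h (T ∩ W) * hProd h (T \ W))
        = hProd h (S ∩ W) * (hProd h (S \ W) * hProd h (T ∩ W)) * hProd h (T \ W) := by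
          simp only [mul_assoc]
      _ = hProd h (S ∩ W) * hProd h (T ∩ W) * (hProd h (S \ W) * hProd h (T \ W)) := by
          rw [c1]; simp only [mul_assoc]
      _ = hProd h (S ∩ W) * (hProd h (T ∩ W) * hProd h (T \ W)) * hProd h (S \ W) := by
          rw [c3]; simp only [mul_assoc]
      _ = _ := by rw [← c2]; simp only [mul_assoc]
  unfold chargeQ
  rw [Finset.sum_mul_sum, Finset.sum_mul_sum, Finset.sum_comm (s := Finset.filter _ _)
    (f := fun S T => hProd h S * hProd h T) (t := Finset.filter (fun S => _ ∧ S.card = i) _),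
    ← Finset.sum_product', ← Finset.sum_product']
  have hmem : ∀ p ∈ (Finset.univ.powerset.filter (fun S => IsIndep G S ∧ S.card = i)) ×ˢ
      (Finset.univ.powerset.filter (fun S => IsIndep G S ∧ S.card = j)),
      (swp dir p.1 p.2, swp dir p.2 p.1) ∈
        (Finset.univ.powerset.filter (fun S => IsIndep G S ∧ S.card = i)) ×ˢ
      (Finset.univ.powerset.filter (fun S => IsIndep G S ∧ S.card = j)) := by
    rintro ⟨S, T⟩ hp
    simp only [Finset.mem_product, Finset.mem_filter, Finset.mem_powerset, Finset.subset_univ,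
      true_and] at hp ⊢
    exact ⟨⟨swp_indep G dir hdir' S T hp.1.1 hp.2.1, by rw [swp_card]; exact hp.1.2⟩,
      ⟨swp_indep G dir hdir' T S hp.2.1 hp.1.1, by rw [swp_card]; exact hp.2.2⟩⟩
  refine Finset.sum_nbij' (fun p => (swp dir p.1 p.2, swp dir p.2 p.1))
    (fun p => (swp dir p.1 p.2, swp dir p.2 p.1)) hmem hmem ?_ ?_ ?_
  · rintro ⟨S, T⟩ _
    simp only [swp_swp]
  · rintro ⟨S, T⟩ _
    simp only [swp_swp]
  · rintro ⟨S, T⟩ hp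
    simp only [Finset.mem_product, Finset.mem_filter, Finset.mem_powerset, Finset.subset_univ,
      true_and] at hp
    exact key S T hp.1.1 hp.2.1


/-- for a Hamiltonian compatible with a dipath-oriented graph, the
transfer operators commute with the Hamiltonian and with each other. -/
theorem transfer_operators_commute
    {V : Type*} [Fintype V] [LinearOrder V] {N : ℕ}
    (d : ℕ) (hd : 2 ≤ d)
    (G : SimpleGraph V) (dir : V → V → Prop)
    (hdir : ∀ u v, dir u v → G.Adj u v)
    (hdir' : ∀ u v, G.Adj u v → (dir u v ↔ ¬ dir v u))
    (hdip : DipathOriented G dir)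
    (h : V → Matrix (Fin N) (Fin N) ℂ) (b : V → ℝ)
    (hb : ∀ v, b v ≠ 0)
    (hpow : ∀ v, h v ^ d = ((b v : ℂ) ^ d) • (1 : Matrix (Fin N) (Fin N) ℂ))
    (hcd : ∀ u v, dir u v → h u * h v = omegaD d • (h v * h u))
    (hcn : ∀ u v, u ≠ v → ¬ G.Adj u v → h u * h v = h v * h u) :
    ∀ x y : ℂ,
      (∑ v, h v) * transferT G h Finset.univ x =
          transferT G h Finset.univ x * (∑ v, h v) ∧
        transferT G h Finset.univ x * transferT G h Finset.univ y =
          transferT G h Finset.univ y * transferT G h Finset.univ x := by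
  intro x y
  have hw : omegaD d ≠ 0 := Complex.exp_ne_zero _
  have hQ := chargeQ_comm G dir hdir hdir' hdip h (omegaD d) hw hcd hcn
  have hH : (∑ v, h v) = chargeQ G h Finset.univ 1 := by
    unfold chargeQ
    refine Finset.sum_bij (fun v _ => {v}) ?_ ?_ ?_ ?_
    · intro v _
      simp [IsIndep]
    · intro a _ b _ hab
      simpa using hab
    · intro S hS
      simp only [Finset.mem_filter] at hS
      obtain ⟨v, rfl⟩ := Finset.card_eq_one.1 hS.2.2
      exact ⟨v, Finset.mem_univ _, rfl⟩
    · intro v _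
      simp [hProd]
  have hT : ∀ (X : Matrix (Fin N) (Fin N) ℂ),
      (∀ k, Commute X (chargeQ G h Finset.univ k)) → ∀ z,
      Commute X (transferT G h Finset.univ z) := by
    intro X hX z
    unfold transferT
    exact Commute.sum_right _ _ _ (fun k _ => (hX k).smul_right _)
  constructor
  · rw [hH]
    exact hT _ (fun k => hQ 1 k) x
  · exact hT _ (fun k => (hT _ (fun l => hQ k l) x).symm) y
end
end

section
/- Let G be an oriented indifference graph with a fixed oriented perfect elimination ordering whose last vertex is v, let (h_u)_{u∈V} be a Hamiltonian compatible with G, and let χ be a simplicial mode. Then for all p ∈ ℤ and all u ∈ ℂ, ω^{p+1} · (T_G(u ω^{−p}) χ − χ T_G(u ω^{−p})) = (1−ω) · u · h_v · χ · T_{G∖N[v]}(u ω^{−p}). -/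
noncomputable section
open scoped Classical

/-- `f` is an oriented perfect elimination ordering of the oriented graph `(G, dir)`:
it is an injective labelling of the vertices such that for every vertex the earlier
neighbours form a clique, and every directed edge points forwards. -/
def IsOPEO {V : Type*} (G : SimpleGraph V) (dir : V → V → Prop) (f : V → ℕ) : Prop :=
  Function.Injective f ∧
    (∀ v u w, G.Adj u v → G.Adj w v → f u < f v → f w < f v → u ≠ w → G.Adj u w) ∧
    (∀ u w, dir u w → f u < f w)
/-- The closed neighbourhood `N[v]` of a vertex. -/
def closedNbhd {V : Type*} [Fintype V] (G : SimpleGraph V) (v : V) : Finset V :=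
  insert v (Finset.univ.filter (fun u => G.Adj v u))
theorem transferT_eq {V : Type*} [LinearOrder V] {N : ℕ} (G : SimpleGraph V)
    (h : V → Matrix (Fin N) (Fin N) ℂ) (A : Finset V) (x : ℂ) :
    transferT G h A x =
      ∑ S ∈ A.powerset.filter (fun S => IsIndep G S), (-x) ^ S.card • hProd h S := by
  unfold transferT chargeQ
  rw [← Finset.sum_fiberwise_of_maps_to
    (s := A.powerset.filter (fun S => IsIndep G S))
    (t := Finset.range (indepNum G A + 1)) (g := Finset.card)]
  · refine Finset.sum_congr rfl fun k _ => ?_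
    rw [Finset.smul_sum, Finset.filter_filter]
    refine Finset.sum_congr rfl fun S hS => ?_
    rw [(Finset.mem_filter.1 hS).2.2]
  · intro S hS
    rw [Finset.mem_range, Nat.lt_succ_iff]
    exact Finset.le_sup (f := Finset.card) hS

theorem hProd_comm {V : Type*} [LinearOrder V] {N : ℕ}
    (h : V → Matrix (Fin N) (Fin N) ℂ) (S : Finset V) (χ : Matrix (Fin N) (Fin N) ℂ)
    (hc : ∀ u ∈ S, χ * h u = h u * χ) : χ * hProd h S = hProd h S * χ := by
  have : Commute χ (hProd h S) := by
    unfold hProd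
    apply Commute.list_prod_right
    intro y hy
    obtain ⟨u, hu, rfl⟩ := List.mem_map.1 hy
    exact hc u (by simpa using hu)
  exact this

theorem hProd_insert {V : Type*} [LinearOrder V] {N : ℕ}
    (h : V → Matrix (Fin N) (Fin N) ℂ) (S : Finset V) (v : V) (hv : v ∉ S)
    (hc : ∀ u ∈ insert v S, ∀ w ∈ insert v S, h u * h w = h w * h u) :
    hProd h (insert v S) = h v * hProd h S := by
  unfold hProd
  have hp : ((insert v S).sort (· ≤ ·)).Perm (v :: S.sort (· ≤ ·)) := by
    rw [List.perm_ext_iff_of_nodup (Finset.sort_nodup _ _)]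
    · intro a; simp
    · exact List.nodup_cons.2 ⟨by simpa using hv, Finset.sort_nodup _ _⟩
  rw [(hp.map h).prod_eq', List.map_cons, List.prod_cons]
  apply List.pairwise_of_forall_mem_list
  intro a ha b hb
  obtain ⟨u, hu, rfl⟩ := List.mem_map.1 ha
  obtain ⟨w, hw, rfl⟩ := List.mem_map.1 hb
  exact hc u (by simpa using hu) w (by simpa using hw)

/-- commutator of the transfer operator with a simplicial mode. -/
theorem transfer_simplicial_commutator
    {V : Type*} [Fintype V] [LinearOrder V] {N : ℕ}
    (d : ℕ) (hd : 2 ≤ d)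
    (G : SimpleGraph V) (dir : V → V → Prop)
    (hdir : ∀ u v, dir u v → G.Adj u v)
    (hdir' : ∀ u v, G.Adj u v → (dir u v ↔ ¬ dir v u))
    (hdip : DipathOriented G dir)
    (f : V → ℕ) (hopeo : IsOPEO G dir f)
    (v : V) (hlast : ∀ u, u ≠ v → f u < f v)
    (h : V → Matrix (Fin N) (Fin N) ℂ) (b : V → ℝ)
    (hb : ∀ w, b w ≠ 0)
    (hpow : ∀ w, h w ^ d = ((b w : ℂ) ^ d) • (1 : Matrix (Fin N) (Fin N) ℂ))
    (hcd : ∀ u w, dir u w → h u * h w = omegaD d • (h w * h u))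
    (hcn : ∀ u w, u ≠ w → ¬ G.Adj u w → h u * h w = h w * h u)
    (χ : Matrix (Fin N) (Fin N) ℂ) (hχ : IsUnit χ)
    (hχcomm : ∀ u, u ≠ v → χ * h u = h u * χ)
    (hχv : h v * χ = omegaD d • (χ * h v)) :
    ∀ (p : ℤ) (u : ℂ),
      omegaD d ^ (p + 1) •
          (transferT G h Finset.univ (u * omegaD d ^ (-p)) * χ -
            χ * transferT G h Finset.univ (u * omegaD d ^ (-p))) =
        ((1 - omegaD d) * u) •
          (h v * χ * transferT G h (Finset.univ \ closedNbhd G v) (u * omegaD d ^ (-p))) := by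
  intro p u
  have hω : omegaD d ≠ 0 := Complex.exp_ne_zero _
  set ω := omegaD d with hωd
  set x := u * ω ^ (-p) with hx
  have key : transferT G h Finset.univ x * χ - χ * transferT G h Finset.univ x =
      (-x) • ((h v * χ - χ * h v) * transferT G h (Finset.univ \ closedNbhd G v) x) := by
    simp only [transferT_eq]
    rw [Finset.sum_mul, Finset.mul_sum, ← Finset.sum_sub_distrib, Finset.mul_sum,
      Finset.smul_sum]
    rw [← Finset.sum_filter_add_sum_filter_not _ (fun S : Finset V => v ∈ S)]
    rw [add_eq_left.2]
    · symm
      refine Finset.sum_bij (fun S _ => insert v S) ?_ ?_ ?_ ?_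
      · intro S hS
        simp only [Finset.mem_filter, Finset.mem_powerset] at hS
        obtain ⟨hS, hi⟩ := hS
        have hN : ∀ w ∈ S, ¬ G.Adj v w := fun w hw => by
          have := hS hw
          simp [closedNbhd] at this
          exact this.2
        simp only [Finset.mem_filter, Finset.mem_powerset, Finset.subset_univ, true_and,
          Finset.mem_insert_self, and_true]
        intro a ha b hb hab
        rcases Finset.mem_insert.1 ha with rfl | ha' <;>
          rcases Finset.mem_insert.1 hb with rfl | hb'
        · exact absurd rfl hab
        · exact hN _ hb'
        · exact fun h => hN _ ha' h.symm
        · exact hi a ha' b hb' hab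
      · intro S hS S' hS' e
        have nv : ∀ S ∈ (Finset.univ \ closedNbhd G v).powerset.filter
            (fun S => IsIndep G S), v ∉ S := by
          intro S hS hv
          have := (Finset.mem_powerset.1 (Finset.mem_filter.1 hS).1) hv
          simp [closedNbhd] at this
        rw [← Finset.erase_insert (nv S hS), ← Finset.erase_insert (nv S' hS')]
        exact congrArg (fun T => Finset.erase T v) e
      · intro S hS
        simp only [Finset.mem_filter, Finset.mem_powerset, Finset.subset_univ, true_and] at hS
        refine ⟨S.erase v, ?_, Finset.insert_erase hS.2⟩
        simp only [Finset.mem_filter, Finset.mem_powerset]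
        constructor
        · intro w hw
          rw [Finset.mem_erase] at hw
          simp only [closedNbhd, Finset.mem_sdiff, Finset.mem_univ, true_and,
            Finset.mem_insert, Finset.mem_filter, not_or]
          exact ⟨hw.1, hS.1 v hS.2 w hw.2 hw.1.symm⟩
        · intro a ha b hb
          exact hS.1 a (Finset.mem_of_mem_erase ha) b (Finset.mem_of_mem_erase hb)
      · intro S hS
        simp only [Finset.mem_filter, Finset.mem_powerset] at hS
        obtain ⟨hS, hi⟩ := hS
        have hN : ∀ w ∈ S, w ≠ v ∧ ¬ G.Adj v w := fun w hw => by
          have := hS hw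
          simpa [closedNbhd] using this
        have hv : v ∉ S := fun hv => (hN v hv).1 rfl
        have hins : hProd h (insert v S) = h v * hProd h S := by
          apply hProd_insert h S v hv
          intro a ha b hb
          by_cases hab : a = b
          · rw [hab]
          apply hcn a b hab
          rcases Finset.mem_insert.1 ha with rfl | ha' <;>
            rcases Finset.mem_insert.1 hb with rfl | hb'
          · exact absurd rfl hab
          · exact (hN _ hb').2
          · exact fun h => (hN _ ha').2 h.symm
          · exact hi a ha' b hb' hab
        have hc := hProd_comm h S χ (fun w hw => hχcomm w (hN w hw).1)
        rw [hins, Finset.card_insert_of_notMem hv, smul_mul_assoc, mul_smul_comm, mul_smul_comm,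
          ← smul_sub, smul_smul, pow_succ', sub_mul, mul_assoc (h v) χ, hc]
        simp only [mul_assoc]
    · refine Finset.sum_eq_zero fun S hS => ?_
      have hv := (Finset.mem_filter.1 hS).2
      rw [smul_mul_assoc, mul_smul_comm, hProd_comm h S χ, sub_self]
      intro w hw
      exact hχcomm w (fun e => hv (e ▸ hw))
  have h2 : χ * h v = ω⁻¹ • (h v * χ) := by
    rw [hχv, smul_smul, inv_mul_cancel₀ hω, one_smul]
  have h3 : h v * χ - χ * h v = (1 - ω⁻¹) • (h v * χ) := by
    rw [h2, sub_smul, one_smul]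
  rw [key, h3, smul_mul_assoc, smul_smul, smul_smul]
  congr 1
  rw [hx, zpow_add₀ hω, zpow_neg, zpow_one]
  have := zpow_ne_zero p hω
  field_simp
  ring
end
end
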